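/- arXiv:1708.06522 — 2 statements merged into one kernel-verified Lean document; each statement's English description precedes it below -/
import Mathlib

section
/- Let ψ be a unit vector in H_A⊗H_B, and suppose P_A^{(0)},…,P_A^{(d−1)} are projections on H_A with P_A^{(i)}P_A^{(j)}ψ = 0 for all i ≠ j, ∑_k P_A^{(k)} ψ = ψ, projections P_B^{(k)} on H_B with P_A^{(k)}ψ = P_B^{(k)}ψ for all k, and unitaries X_A^{(k)} on H_A, X_B^{(k)} on H_B with X_A^{(k)}X_B^{(k)}P_A^{(k)}ψ = (c_k/c_0) P_A^{(0)}ψ, where 0 < c_i < 1 and ∑ c_i² = 1. Then there is a local isometry Φ = Φ_A ⊗ Φ_B and a state |extra⟩ such that Φ(ψ) = |extra⟩ ⊗ ∑_{i=0}^{d−1} c_i |ii⟩. -/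
open Matrix
open scoped Kronecker

/-- The action of `M ⊗ N` on `ℂ^{ιA} ⊗ ℂ^{ιB} ≅ ℂ^{ιA × ιB}`. -/
noncomputable def kAct {ιA ιB : Type*} [Fintype ιA] [Fintype ιB]
    [DecidableEq ιA] [DecidableEq ιB]
    (M : Matrix ιA ιA ℂ) (Nm : Matrix ιB ιB ℂ) (ψ : EuclideanSpace ℂ (ιA × ιB)) :
    EuclideanSpace ℂ (ιA × ιB) :=
  Matrix.toEuclideanLin (M ⊗ₖ Nm) ψ

/-- The action of a rectangular `M ⊗ N` (a local map `Φ_A ⊗ Φ_B`). -/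
noncomputable def kActRect {ιA ιB κA κB : Type*} [Fintype ιA] [Fintype ιB]
    [Fintype κA] [Fintype κB] [DecidableEq ιA] [DecidableEq ιB]
    (M : Matrix κA ιA ℂ) (Nm : Matrix κB ιB ℂ) (ψ : EuclideanSpace ℂ (ιA × ιB)) :
    EuclideanSpace ℂ (κA × κB) :=
  Matrix.toEuclideanLin (M ⊗ₖ Nm) ψ

/-- Sequential measurement: from projections build Kraus operators. -/
theorem ynKraus {ι : Type} [Fintype ι] [DecidableEq ι] (P : ℕ → Matrix ι ι ℂ)
    (hP : ∀ k, (P k).IsHermitian ∧ P k * P k = P k) :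
    ∃ (K R : ℕ → Matrix ι ι ℂ),
      (∀ n, ∑ k ∈ Finset.range n, (K k)ᴴ * K k + (R n)ᴴ * R n = 1) ∧
      (∀ {κ : Type} [Fintype κ] [DecidableEq κ] (M : Matrix ι κ ℂ),
        (∀ i j, i ≠ j → P i * P j * M = 0) →
        (∀ n, R n * M = M - ∑ k ∈ Finset.range n, P k * M) ∧ (∀ k, K k * M = P k * M)) := by
  let R : ℕ → Matrix ι ι ℂ := fun n => Nat.rec 1 (fun k r => (1 - P k) * r) n
  have hR0 : R 0 = 1 := rfl
  have hRs : ∀ n, R (n+1) = (1 - P n) * R n := fun n => rfl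
  refine ⟨fun k => P k * R k, R, ?_, ?_⟩
  · intro n
    induction n with
    | zero => simp [hR0]
    | succ n ih =>
      rw [Finset.sum_range_succ, hRs, add_assoc]
      refine Eq.trans ?_ ih
      congr 1
      show (P n * R n)ᴴ * (P n * R n) + _ = _
      rw [conjTranspose_mul, conjTranspose_mul, conjTranspose_sub, conjTranspose_one,
        (hP n).1.eq]
      have h1 : (R n)ᴴ * P n * (P n * R n) = (R n)ᴴ * P n * R n := by
        rw [Matrix.mul_assoc, ← Matrix.mul_assoc (P n), (hP n).2, Matrix.mul_assoc]
      have h2 : (1 - P n) * ((1 - P n) * R n) = R n - P n * R n := by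
        have : (1 - P n) * (1 - P n) = 1 - P n := by
          simp [Matrix.sub_mul, Matrix.mul_sub, (hP n).2]
        rw [← Matrix.mul_assoc, this, Matrix.sub_mul, Matrix.one_mul]
      rw [h1, Matrix.mul_assoc (R n)ᴴ (1 - P n), h2, Matrix.mul_sub, Matrix.mul_assoc]
      abel
  · intro κ _ _ M hM
    have hR : ∀ n, R n * M = M - ∑ k ∈ Finset.range n, P k * M := by
      intro n
      induction n with
      | zero => simp [hR0]
      | succ n ih =>
        rw [hRs, Matrix.mul_assoc, ih, Finset.sum_range_succ, Matrix.sub_mul, Matrix.one_mul,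
          Matrix.mul_sub, Matrix.mul_sum]
        have hz : ∑ k ∈ Finset.range n, P n * (P k * M) = 0 := by
          refine Finset.sum_eq_zero fun k hk => ?_
          rw [← Matrix.mul_assoc]
          exact hM _ _ (Finset.mem_range.1 hk).ne'
        rw [hz, sub_zero]
        abel
    refine ⟨hR, fun n => ?_⟩
    show P n * R n * M = _
    rw [Matrix.mul_assoc, hR, Matrix.mul_sub, Matrix.mul_sum, Finset.sum_eq_zero, sub_zero]
    intro k hk
    rw [← Matrix.mul_assoc]
    exact hM _ _ (Finset.mem_range.1 hk).ne'

theorem ynIso {ι : Type} [Fintype ι] [DecidableEq ι] (d : ℕ) (hd : 0 < d)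
    (P X : Fin d → Matrix ι ι ℂ)
    (hP : ∀ k, (P k).IsHermitian ∧ P k * P k = P k) (hX : ∀ k, (X k)ᴴ * X k = 1) :
    ∃ (n : ℕ) (G : Fin d → Matrix (Fin n) ι ℂ) (J : Matrix (Fin n) ι ℂ),
      Jᴴ * J = 1 ∧ ∑ k, (G k)ᴴ * G k = 1 ∧
      (∀ {κ : Type} [Fintype κ] [DecidableEq κ] (M : Matrix ι κ ℂ),
        (∀ i j, i ≠ j → P i * P j * M = 0) → (∑ k, P k) * M = M →
        ∀ k, G k * M = J * X k * P k * M) := by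
  let P' : ℕ → Matrix ι ι ℂ := fun k => if h : k < d then P ⟨k, h⟩ else 0
  have hP' : ∀ k, (P' k).IsHermitian ∧ P' k * P' k = P' k := by
    intro k
    by_cases h : k < d
    · simp only [P', h, dif_pos]; exact hP _
    · simp [P', h]
  have hPP : ∀ k : Fin d, P' k = P k := fun k => by simp [P']
  obtain ⟨K, R, hKR, hM⟩ := ynKraus P' hP'
  let e := Fintype.equivFin (ι ⊕ ι)
  let J : Matrix (Fin (Fintype.card (ι ⊕ ι))) ι ℂ :=
    (1 : Matrix _ _ ℂ).submatrix id (fun a => e (Sum.inl a))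
  let J' : Matrix (Fin (Fintype.card (ι ⊕ ι))) ι ℂ :=
    (1 : Matrix _ _ ℂ).submatrix id (fun a => e (Sum.inr a))
  have hJ : Jᴴ * J = 1 := by
    ext a b; simp [J, Matrix.mul_apply, Matrix.one_apply, eq_comm]
  have hJ' : J'ᴴ * J' = 1 := by
    ext a b; simp [J', Matrix.mul_apply, Matrix.one_apply, eq_comm]
  have hJJ' : Jᴴ * J' = 0 := by
    ext a b; simp [J, J', Matrix.mul_apply, Matrix.one_apply]
  have hJ'J : J'ᴴ * J = 0 := by
    ext a b; simp [J, J', Matrix.mul_apply, Matrix.one_apply]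
  let S : Fin d → Matrix ι ι ℂ := fun k => if k = ⟨0, hd⟩ then R d else 0
  refine ⟨_, fun k => J * (X k * K k) + J' * S k, J, hJ, ?_, ?_⟩
  · have key : ∀ k, (J * (X k * K k) + J' * S k)ᴴ * (J * (X k * K k) + J' * S k)
        = (K k)ᴴ * K k + (S k)ᴴ * S k := by
      intro k
      have e1 : ∀ (U V : Matrix (Fin (Fintype.card (ι ⊕ ι))) ι ℂ) (A B : Matrix ι ι ℂ),
          Aᴴ * Uᴴ * (V * B) = Aᴴ * (Uᴴ * V) * B := by
        intro U V A B; simp only [Matrix.mul_assoc]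
      have e2 : (X k * K k)ᴴ * (X k * K k) = (K k)ᴴ * K k := by
        rw [conjTranspose_mul, Matrix.mul_assoc, ← Matrix.mul_assoc (X k)ᴴ, hX, Matrix.one_mul]
      rw [conjTranspose_add, Matrix.add_mul, Matrix.mul_add, Matrix.mul_add,
        conjTranspose_mul J, conjTranspose_mul J', e1, e1, e1, e1, hJ, hJ', hJJ', hJ'J]
      simp only [Matrix.mul_one, Matrix.mul_zero, Matrix.zero_mul, add_zero, zero_add, e2]
    rw [Finset.sum_congr rfl (fun k _ => key k), Finset.sum_add_distrib, ← hKR d,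
      ← Fin.sum_univ_eq_sum_range (fun k => (K k)ᴴ * K k)]
    congr 1
    rw [Finset.sum_eq_single ⟨0, hd⟩]
    · simp [S]
    · intro b _ hb; simp [S, hb]
    · simp
  · intro κ _ _ M h1 h2 k
    obtain ⟨hRM, hKM⟩ := hM M (by
      intro i j hij
      by_cases hi : i < d
      · by_cases hj : j < d
        · simp only [P', hi, hj, dif_pos]
          exact h1 _ _ (by simpa using hij)
        · simp [P', hj]
      · simp [P', hi])
    have hS : S k * M = 0 := by
      by_cases hk : k = ⟨0, hd⟩
      · simp only [S, hk, if_true]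
        rw [hRM, ← Fin.sum_univ_eq_sum_range (fun k => P' k * M)]
        simp only [hPP]
        rw [← Matrix.sum_mul, h2, sub_self]
      · simp [S, hk]
    rw [Matrix.add_mul, Matrix.mul_assoc J', hS, Matrix.mul_zero, add_zero, Matrix.mul_assoc,
      Matrix.mul_assoc, hKM, hPP]
    simp only [Matrix.mul_assoc]

theorem ynAct {ιA ιB κA κB : Type} [Fintype ιA] [Fintype ιB]
    [Fintype κA] [Fintype κB] [DecidableEq ιA] [DecidableEq ιB]
    (A : Matrix κA ιA ℂ) (B : Matrix κB ιB ℂ) (ψ : EuclideanSpace ℂ (ιA × ιB)) (p : κA × κB) :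
    kActRect A B ψ p = (A * Matrix.of (fun a b => ψ (a, b)) * Bᵀ) p.1 p.2 := by
  simp only [kActRect, Matrix.toLpLin_apply, Matrix.mulVec, dotProduct,
    Matrix.mul_apply, Fintype.sum_prod_type, kroneckerMap_apply, transpose_apply, of_apply,
    Finset.sum_mul]
  rw [Finset.sum_comm]
  refine Finset.sum_congr rfl fun _ _ => Finset.sum_congr rfl fun _ _ => ?_
  ring

theorem ynActM {ιA ιB : Type} [Fintype ιA] [Fintype ιB] [DecidableEq ιA] [DecidableEq ιB]
    (A : Matrix ιA ιA ℂ) (B : Matrix ιB ιB ℂ) (ψ : EuclideanSpace ℂ (ιA × ιB)) :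
    Matrix.of (fun a b => kAct A B ψ (a, b)) = A * Matrix.of (fun a b => ψ (a, b)) * Bᵀ := by
  ext a b
  exact ynAct A B ψ (a, b)

theorem ynNorm {α β : Type} [Fintype α] [Fintype β] [DecidableEq α] [DecidableEq β]
    (ψ : EuclideanSpace ℂ (α × β)) :
    ((‖ψ‖ ^ 2 : ℝ) : ℂ) =
      ((Matrix.of (fun a b => ψ (a, b)))ᴴ * Matrix.of (fun a b => ψ (a, b))).trace := by
  rw [EuclideanSpace.norm_sq_eq]
  simp only [Matrix.trace, Matrix.diag, Matrix.mul_apply, Fintype.sum_prod_type,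
    conjTranspose_apply, of_apply]
  push_cast
  rw [Finset.sum_comm]
  refine Finset.sum_congr rfl fun _ _ => Finset.sum_congr rfl fun _ _ => ?_
  exact (RCLike.conj_mul _).symm

theorem ynTrace {α β γ δ : Type} [Fintype α] [Fintype β] [Fintype γ] [Fintype δ]
    [DecidableEq α] [DecidableEq β] (U : Matrix γ α ℂ) (V : Matrix δ β ℂ) (N : Matrix α β ℂ)
    (hU : Uᴴ * U = 1) (hV : Vᴴ * V = 1) :
    ((U * N * Vᵀ)ᴴ * (U * N * Vᵀ)).trace = (Nᴴ * N).trace := by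
  have hV' : Vᵀ * (Vᵀ)ᴴ = 1 := by
    have := congrArg Matrix.transpose hV
    rw [transpose_mul, transpose_one] at this
    exact this
  have h : (U * N * Vᵀ)ᴴ * (U * N * Vᵀ) = (Vᵀ)ᴴ * (Nᴴ * N * Vᵀ) := by
    rw [conjTranspose_mul, conjTranspose_mul]
    simp only [Matrix.mul_assoc]
    rw [← Matrix.mul_assoc Uᴴ, hU, Matrix.one_mul]
  rw [h, Matrix.trace_mul_comm, Matrix.mul_assoc, hV', Matrix.mul_one]

/-- The exact Yang–Navascués self-testing criterion: given projections `P_A^{(k)}`, `P_B^{(k)}`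
and unitaries `X_A^{(k)}`, `X_B^{(k)}` satisfying the four conditions exactly on a unit state
`ψ`, there is a local isometry `Φ_A ⊗ Φ_B` mapping `ψ` to `|extra⟩ ⊗ ∑_i c_i |ii⟩`. -/
theorem stmt11 {ιA ιB : Type} [Fintype ιA] [Fintype ιB] [DecidableEq ιA] [DecidableEq ιB]
    (d : ℕ) (hd : 0 < d) (c : Fin d → ℝ)
    (hc : ∀ i, 0 < c i ∧ c i < 1) (hcsum : ∑ i, c i ^ 2 = 1)
    (ψ : EuclideanSpace ℂ (ιA × ιB)) (hψ : ‖ψ‖ = 1)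
    (PA : Fin d → Matrix ιA ιA ℂ) (PB : Fin d → Matrix ιB ιB ℂ)
    (XA : Fin d → Matrix ιA ιA ℂ) (XB : Fin d → Matrix ιB ιB ℂ)
    (hPA : ∀ k, (PA k).IsHermitian ∧ PA k * PA k = PA k)
    (hPB : ∀ k, (PB k).IsHermitian ∧ PB k * PB k = PB k)
    (hXA : ∀ k, XA k * (XA k)ᴴ = 1 ∧ (XA k)ᴴ * XA k = 1)
    (hXB : ∀ k, XB k * (XB k)ᴴ = 1 ∧ (XB k)ᴴ * XB k = 1)
    (h1 : ∀ i j, i ≠ j → kAct (PA i * PA j) 1 ψ = 0)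
    (h2 : kAct (∑ k, PA k) 1 ψ = ψ)
    (h3 : ∀ k, kAct (PA k) 1 ψ = kAct 1 (PB k) ψ)
    (h4 : ∀ k, kAct (XA k) (XB k) (kAct (PA k) 1 ψ)
            = ((c k / c ⟨0, hd⟩ : ℝ) : ℂ) • kAct (PA ⟨0, hd⟩) 1 ψ) :
    ∃ (nA nB : ℕ)
      (ΦA : Matrix (Fin nA × Fin d) ιA ℂ) (ΦB : Matrix (Fin nB × Fin d) ιB ℂ)
      (extra : EuclideanSpace ℂ (Fin nA × Fin nB)),
      ΦAᴴ * ΦA = 1 ∧ ΦBᴴ * ΦB = 1 ∧ ‖extra‖ = 1 ∧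
      ∀ p : (Fin nA × Fin d) × (Fin nB × Fin d),
        kActRect ΦA ΦB ψ p
          = extra (p.1.1, p.2.1) * (if p.1.2 = p.2.2 then ((c p.1.2 : ℝ) : ℂ) else 0) := by
  obtain ⟨nA, G, JA, hJA, hG, hGM⟩ := ynIso d hd PA XA hPA (fun k => (hXA k).2)
  obtain ⟨nB, H, JB, hJB, hH, hHM⟩ := ynIso d hd PB XB hPB (fun k => (hXB k).2)
  set M : Matrix ιA ιB ℂ := Matrix.of (fun a b => ψ (a, b)) with hMdef
  set z : Fin d := ⟨0, hd⟩ with hz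
  have toM : ∀ {φ χ : EuclideanSpace ℂ (ιA × ιB)}, φ = χ →
      Matrix.of (fun a b => φ (a, b)) = Matrix.of (fun a b => χ (a, b)) := by
    rintro φ _ rfl; rfl
  have m1 : ∀ i j, i ≠ j → PA i * PA j * M = 0 := by
    intro i j hij
    have := toM (h1 i j hij)
    rw [ynActM, transpose_one, Matrix.mul_one] at this
    rw [hMdef, this]; ext; simp
  have m2 : (∑ k, PA k) * M = M := by
    have := toM h2
    rwa [ynActM, transpose_one, Matrix.mul_one] at this
  have m3 : ∀ k, PA k * M = M * (PB k)ᵀ := by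
    intro k
    have := toM (h3 k)
    rwa [ynActM, ynActM, transpose_one, Matrix.mul_one, Matrix.one_mul] at this
  have m4 : ∀ k, XA k * (PA k * M) * (XB k)ᵀ = ((c k / c z : ℝ) : ℂ) • (PA z * M) := by
    intro k
    have := toM (h4 k)
    have h5 : Matrix.of (fun a b => (((c k / c z : ℝ) : ℂ) • kAct (PA z) 1 ψ) (a, b))
        = ((c k / c z : ℝ) : ℂ) • Matrix.of (fun a b => kAct (PA z) 1 ψ (a, b)) := by
      ext; simp
    rwa [h5, ynActM, ynActM, ynActM, transpose_one, Matrix.mul_one, Matrix.mul_one] at this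
  have m3' : ∀ k, PB k * Mᵀ = Mᵀ * (PA k)ᵀ := by
    intro k
    have := congrArg Matrix.transpose (m3 k)
    rw [transpose_mul, transpose_mul, transpose_transpose] at this
    exact this.symm
  have m1' : ∀ i j, i ≠ j → PB i * PB j * Mᵀ = 0 := by
    intro i j hij
    rw [Matrix.mul_assoc, m3', ← Matrix.mul_assoc, m3', Matrix.mul_assoc, ← transpose_mul,
      ← transpose_mul, m1 j i hij.symm, transpose_zero]
  have m2' : (∑ k, PB k) * Mᵀ = Mᵀ := by
    rw [Matrix.sum_mul, Finset.sum_congr rfl (fun k _ => m3' k), ← Matrix.mul_sum,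
      ← transpose_sum, ← transpose_mul, m2]
  have hGM' := hGM M m1 m2
  have hHM' : ∀ l, M * (H l)ᵀ = PA l * M * (JB * XB l)ᵀ := by
    intro l
    have := congrArg Matrix.transpose (hHM Mᵀ m1' m2' l)
    rw [transpose_mul, transpose_transpose, Matrix.mul_assoc, m3', transpose_mul, transpose_mul,
      transpose_transpose, transpose_transpose] at this
    exact this
  have hcz : (c z : ℂ) ≠ 0 := by exact_mod_cast (hc z).1.ne'
  have tr1 : (Mᴴ * M).trace = 1 := by
    rw [hMdef, ← ynNorm, hψ]; simp
  have trk : ∀ k, ((PA k * M)ᴴ * (PA k * M)) = Mᴴ * (PA k * M) := by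
    intro k
    rw [conjTranspose_mul, (hPA k).1.eq, Matrix.mul_assoc, ← Matrix.mul_assoc (PA k),
      (hPA k).2]
  have trk' : ∀ k, (Mᴴ * (PA k * M)).trace
      = ((c k : ℂ) ^ 2) * (((c z : ℂ) ^ 2)⁻¹ * (Mᴴ * (PA z * M)).trace) := by
    intro k
    rw [← trk, ← ynTrace (XA k) (XB k) _ (hXA k).2 (hXB k).2, m4, conjTranspose_smul,
      Matrix.smul_mul, Matrix.mul_smul, trk, Matrix.trace_smul, Matrix.trace_smul]
    simp only [smul_eq_mul, Complex.star_def, Complex.conj_ofReal]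
    push_cast
    field_simp
  have tr0 : ((c z : ℂ) ^ 2)⁻¹ * (Mᴴ * (PA z * M)).trace = 1 := by
    have : (Mᴴ * ((∑ k, PA k) * M)).trace = 1 := by rw [m2, tr1]
    rw [Matrix.sum_mul, Matrix.mul_sum, Matrix.trace_sum,
      Finset.sum_congr rfl (fun k _ => trk' k), ← Finset.sum_mul] at this
    have hs : ∑ k, (c k : ℂ) ^ 2 = 1 := by exact_mod_cast hcsum
    rwa [hs, one_mul] at this
  let E : Matrix (Fin nA) (Fin nB) ℂ := JA * ((c z : ℂ)⁻¹ • (PA z * M)) * JBᵀ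
  let extra : EuclideanSpace ℂ (Fin nA × Fin nB) := WithLp.toLp 2 (fun p => E p.1 p.2)
  refine ⟨nA, nB, Matrix.of (fun p a => G p.2 p.1 a), Matrix.of (fun p a => H p.2 p.1 a),
    extra, ?_, ?_, ?_, ?_⟩
  · rw [← hG]
    ext a b
    simp only [Matrix.mul_apply, Matrix.sum_apply, Fintype.sum_prod_type, conjTranspose_apply,
      of_apply]
    rw [Finset.sum_comm]
  · rw [← hH]
    ext a b
    simp only [Matrix.mul_apply, Matrix.sum_apply, Fintype.sum_prod_type, conjTranspose_apply,
      of_apply]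
    rw [Finset.sum_comm]
  · have h := ynNorm extra
    have hE : Matrix.of (fun a b => extra (a, b)) = E := rfl
    rw [hE, ynTrace JA JB _ hJA hJB, conjTranspose_smul, Matrix.smul_mul, Matrix.mul_smul, trk,
      Matrix.trace_smul, Matrix.trace_smul] at h
    simp only [smul_eq_mul, star_inv₀, Complex.star_def, Complex.conj_ofReal] at h
    rw [← mul_assoc, ← mul_inv, ← sq, tr0] at h
    have h' : ‖extra‖ ^ 2 = 1 := by exact_mod_cast h
    exact (pow_eq_one_iff_of_nonneg (norm_nonneg _) two_ne_zero).1 h'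
  · rintro ⟨⟨x, k⟩, ⟨y, l⟩⟩
    rw [ynAct]
    have hGl : G k * M * (H l)ᵀ = if k = l then (c k : ℂ) • E else 0 := by
      rw [Matrix.mul_assoc, hHM', ← Matrix.mul_assoc, m3 l, ← Matrix.mul_assoc, hGM',
        Matrix.mul_assoc _ M, ← m3 l]
      split_ifs with hkl
      · subst hkl
        have : JA * XA k * PA k * (PA k * M) * (JB * XB k)ᵀ
            = JA * (XA k * (PA k * M) * (XB k)ᵀ) * JBᵀ := by
          rw [Matrix.mul_assoc (JA * XA k), ← Matrix.mul_assoc (PA k), (hPA k).2, transpose_mul]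
          simp only [Matrix.mul_assoc]
        rw [this, m4]
        simp only [E, Matrix.mul_smul, Matrix.smul_mul, smul_smul]
        congr 1
        push_cast
        rw [div_eq_mul_inv]
      · rw [Matrix.mul_assoc (JA * XA k), ← Matrix.mul_assoc (PA k), m1 k l hkl]
        simp
    have : (Matrix.of (fun (p : Fin nA × Fin d) a => G p.2 p.1 a) * M *
        (Matrix.of (fun (p : Fin nB × Fin d) a => H p.2 p.1 a))ᵀ) (x, k) (y, l)
        = (G k * M * (H l)ᵀ) x y := by
      simp [Matrix.mul_apply]
    refine this.trans ?_
    rw [hGl]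
    show _ = E x y * _
    by_cases hkl : k = l
    · simp [hkl, mul_comm]
    · simp [hkl]
end

section
/- Under the hypotheses of the Yang–Navascués criterion with error ε (‖P_A^{(i)}P_A^{(j)}ψ‖ ≤ ε for i≠j, ‖(∑_k P_A^{(k)} − 𝟙)ψ‖ ≤ ε, ‖(P_A^{(k)} − P_B^{(k)})ψ‖ ≤ ε, ‖(X_A^{(k)}X_B^{(k)}P_A^{(k)} − (c_k/c_0)P_A^{(0)})ψ‖ ≤ ε), there exists a local isometry Φ and state |extra⟩ with ‖Φ(ψ) − |extra⟩⊗∑_i c_i|ii⟩‖ = O(d^{5/2} ε^{1/2}). -/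
open Matrix
open scoped Kronecker

/-- The vector `|extra⟩ ⊗ ∑_i c_i |ii⟩`. -/
noncomputable def targetVec {nA nB d : ℕ} (extra : EuclideanSpace ℂ (Fin nA × Fin nB))
    (c : Fin d → ℝ) : EuclideanSpace ℂ ((Fin nA × Fin d) × (Fin nB × Fin d)) :=
  (EuclideanSpace.equiv ((Fin nA × Fin d) × (Fin nB × Fin d)) ℂ).symm
    fun p => extra (p.1.1, p.2.1) * (if p.1.2 = p.2.2 then ((c p.1.2 : ℝ) : ℂ) else 0)


section aux
variable {m n p : Type*} [Fintype m] [Fintype n] [Fintype p]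
  [DecidableEq m] [DecidableEq n] [DecidableEq p]

lemma tEL_mul (M : Matrix m n ℂ) (N : Matrix n p ℂ) (v : EuclideanSpace ℂ p) :
    Matrix.toEuclideanLin (M * N) v = Matrix.toEuclideanLin M (Matrix.toEuclideanLin N v) := by
  ext i
  simp [Matrix.toEuclideanLin, Matrix.mulVec_mulVec]

lemma L_inner (M : Matrix m n ℂ) (v : EuclideanSpace ℂ n) (w : EuclideanSpace ℂ m) :
    inner ℂ (Matrix.toEuclideanLin M v) w = inner ℂ v (Matrix.toEuclideanLin Mᴴ w) := by
  rw [Matrix.toEuclideanLin_conjTranspose_eq_adjoint, LinearMap.adjoint_inner_right]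

lemma tEL_one (v : EuclideanSpace ℂ n) : Matrix.toEuclideanLin (1 : Matrix n n ℂ) v = v := by
  ext i
  simp [Matrix.toEuclideanLin]

lemma L_iso (M : Matrix m n ℂ) (h : Mᴴ * M = 1) (v : EuclideanSpace ℂ n) :
    ‖Matrix.toEuclideanLin M v‖ = ‖v‖ := by
  have h1 : inner ℂ (Matrix.toEuclideanLin M v) (Matrix.toEuclideanLin M v) = inner ℂ v v := by
    rw [L_inner, ← tEL_mul, h, tEL_one]
  rw [inner_self_eq_norm_sq_to_K, inner_self_eq_norm_sq_to_K] at h1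
  have h2 : ‖Matrix.toEuclideanLin M v‖ ^ 2 = ‖v‖ ^ 2 := by exact_mod_cast h1
  exact (sq_eq_sq₀ (norm_nonneg _) (norm_nonneg _)).1 h2

lemma L_proj (P : Matrix n n ℂ) (h : P.IsHermitian) (h' : P * P = P) (v : EuclideanSpace ℂ n) :
    ‖Matrix.toEuclideanLin P v‖ ≤ ‖v‖ := by
  have h1 : inner ℂ (Matrix.toEuclideanLin P v) (Matrix.toEuclideanLin P v)
      = inner ℂ v (Matrix.toEuclideanLin P v) := by
    rw [L_inner, ← tEL_mul, h.eq, h']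
  have h2 : ‖Matrix.toEuclideanLin P v‖ ^ 2 ≤ ‖v‖ * ‖Matrix.toEuclideanLin P v‖ := by
    have := norm_inner_le_norm (𝕜 := ℂ) v (Matrix.toEuclideanLin P v)
    rw [← h1, inner_self_eq_norm_sq_to_K] at this
    simpa using this
  by_contra hc
  push Not at hc
  have := norm_nonneg v
  nlinarith

/-- isometry comparison -/
lemma L_cmp (W G : Matrix m n ℂ) (hW : Wᴴ * W = 1) (hG : Gᴴ * G = 1) (φ : EuclideanSpace ℂ n)
    (η : ℝ) (h : ‖φ - Matrix.toEuclideanLin (Gᴴ * W) φ‖ ≤ η) (hφ : ‖φ‖ ≤ 1) :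
    ‖Matrix.toEuclideanLin W φ - Matrix.toEuclideanLin G φ‖ ^ 2 ≤ 2 * η := by
  rw [norm_sub_rev, @norm_sub_sq ℂ, L_iso W hW, L_iso G hG, L_inner, ← tEL_mul]
  have h1 : RCLike.re (inner ℂ φ (φ - Matrix.toEuclideanLin (Gᴴ * W) φ)) ≤ η := by
    refine (RCLike.re_le_norm _).trans ((norm_inner_le_norm _ _).trans ?_)
    have := norm_nonneg (φ - Matrix.toEuclideanLin (Gᴴ * W) φ)
    have := norm_nonneg φ
    nlinarith
  rw [inner_sub_right, map_sub, inner_self_eq_norm_sq] at h1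
  linarith

/-- Sequential product. -/
noncomputable def seqS (P : ℕ → Matrix n n ℂ) : ℕ → Matrix n n ℂ
  | 0 => 1
  | k + 1 => (1 - P k) * seqS P k

lemma seqS_sum (P : ℕ → Matrix n n ℂ) (h : ∀ k, (P k).IsHermitian) (h' : ∀ k, P k * P k = P k)
    (d : ℕ) : ∑ k ∈ Finset.range d, (P k * seqS P k)ᴴ * (P k * seqS P k)
      = 1 - (seqS P d)ᴴ * seqS P d := by
  induction d with
  | zero => simp [seqS]
  | succ k ih =>
    rw [Finset.sum_range_succ, ih, seqS]
    simp only [Matrix.conjTranspose_mul, Matrix.conjTranspose_sub, Matrix.conjTranspose_one,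
      (h k).eq]
    have e1 : (seqS P k)ᴴ * P k * (P k * seqS P k) = (seqS P k)ᴴ * (P k * seqS P k) := by
      rw [Matrix.mul_assoc, ← Matrix.mul_assoc (P k) (P k), h']
    have e2 : (1 - P k) * ((1 - P k) * seqS P k) = (1 - P k) * seqS P k := by
      rw [← Matrix.mul_assoc]
      congr 1
      rw [sub_mul, mul_sub, mul_one, one_mul, mul_sub, mul_one, h']
      simp
    rw [e1, Matrix.mul_assoc, e2, sub_mul, one_mul, mul_sub]
    abel

lemma seq_err {E : Type*} [NormedAddCommGroup E] [NormedSpace ℂ E] (Q : ℕ → E →ₗ[ℂ] E)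
    (s : ℕ → E) (φ : E) (δ : ℝ) (h0 : s 0 = φ) (hs : ∀ k, s (k + 1) = s k - Q k (s k))
    (hQ : ∀ k v, ‖v - Q k v‖ ≤ ‖v‖) (k : ℕ) (hk : ∀ i < k, ‖Q i φ‖ ≤ δ) :
    ‖s k - φ‖ ≤ k * δ := by
  induction k with
  | zero => simp [h0]
  | succ k ih =>
    have := ih (fun i hi => hk i (by omega))
    have e : s (k + 1) - φ = ((s k - φ) - Q k (s k - φ)) - Q k φ := by
      rw [hs, map_sub]; abel
    rw [e]
    have h1 := norm_sub_le ((s k - φ) - Q k (s k - φ)) (Q k φ)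
    have h2 := hQ k (s k - φ)
    have h3 := hk k (by omega)
    push_cast
    linarith

end aux

section act
variable {ιA ιB κA κB : Type*} [Fintype ιA] [Fintype ιB] [DecidableEq ιA] [DecidableEq ιB]
  [Fintype κA] [Fintype κB] [DecidableEq κA] [DecidableEq κB]

lemma kAct_mul (M M' : Matrix ιA ιA ℂ) (N N' : Matrix ιB ιB ℂ) (v : EuclideanSpace ℂ (ιA × ιB)) :
    kAct (M * M') (N * N') v = kAct M N (kAct M' N' v) := by
  simp only [kAct]
  rw [Matrix.mul_kronecker_mul, tEL_mul]

lemma kActRect_mul (M : Matrix κA ιA ℂ) (M' : Matrix ιA ιA ℂ) (N : Matrix κB ιB ℂ)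
    (N' : Matrix ιB ιB ℂ) (v : EuclideanSpace ℂ (ιA × ιB)) :
    kActRect (M * M') (N * N') v = kActRect M N (kAct M' N' v) := by
  simp only [kAct, kActRect]
  rw [Matrix.mul_kronecker_mul, tEL_mul]

lemma kron_iso {M : Matrix κA ιA ℂ} {N : Matrix κB ιB ℂ} (hM : Mᴴ * M = 1) (hN : Nᴴ * N = 1) :
    (M ⊗ₖ N)ᴴ * (M ⊗ₖ N) = 1 := by
  rw [Matrix.conjTranspose_kronecker, ← Matrix.mul_kronecker_mul, hM, hN, Matrix.one_kronecker_one]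

lemma kAct_sub (M : Matrix ιA ιA ℂ) (N : Matrix ιB ιB ℂ) (v w : EuclideanSpace ℂ (ιA × ιB)) :
    kAct M N (v - w) = kAct M N v - kAct M N w := by
  simp [kAct]

lemma kAct_projA (P : Matrix ιA ιA ℂ) (h : P.IsHermitian) (h' : P * P = P)
    (v : EuclideanSpace ℂ (ιA × ιB)) : ‖kAct P 1 v‖ ≤ ‖v‖ := by
  apply L_proj
  · rw [Matrix.IsHermitian, Matrix.conjTranspose_kronecker, h.eq, Matrix.conjTranspose_one]
  · rw [← Matrix.mul_kronecker_mul, h', one_mul]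

lemma kAct_projB (P : Matrix ιB ιB ℂ) (h : P.IsHermitian) (h' : P * P = P)
    (v : EuclideanSpace ℂ (ιA × ιB)) : ‖kAct 1 P v‖ ≤ ‖v‖ := by
  apply L_proj
  · rw [Matrix.IsHermitian, Matrix.conjTranspose_kronecker, h.eq, Matrix.conjTranspose_one]
  · rw [← Matrix.mul_kronecker_mul, h', one_mul]

lemma kAct_subA (P Q : Matrix ιA ιA ℂ) (N : Matrix ιB ιB ℂ)
    (v : EuclideanSpace ℂ (ιA × ιB)) : kAct (P - Q) N v = kAct P N v - kAct Q N v := by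
  have : (P - Q) ⊗ₖ N = P ⊗ₖ N - Q ⊗ₖ N := by
    ext i j; simp [sub_mul]
  simp [kAct, this]

lemma kAct_subB (P Q : Matrix ιB ιB ℂ) (N : Matrix ιA ιA ℂ)
    (v : EuclideanSpace ℂ (ιA × ιB)) : kAct N (P - Q) v = kAct N P v - kAct N Q v := by
  have : N ⊗ₖ (P - Q) = N ⊗ₖ P - N ⊗ₖ Q := by
    ext i j; simp [mul_sub]
  simp [kAct, this]

lemma kAct_one (v : EuclideanSpace ℂ (ιA × ιB)) : kAct 1 1 v = v := by
  rw [kAct, Matrix.one_kronecker_one, tEL_one]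

lemma proj_compl {n : Type*} [Fintype n] [DecidableEq n] {P : Matrix n n ℂ}
    (h : P.IsHermitian) (h' : P * P = P) :
    (1 - P).IsHermitian ∧ (1 - P) * (1 - P) = 1 - P := by
  constructor
  · rw [Matrix.IsHermitian, Matrix.conjTranspose_sub, h.eq, Matrix.conjTranspose_one]
  · rw [sub_mul, mul_sub, mul_one, one_mul, mul_sub, mul_one, h']; simp

lemma errA (P : ℕ → Matrix ιA ιA ℂ) (h : ∀ k, (P k).IsHermitian) (h' : ∀ k, P k * P k = P k)
    (φ : EuclideanSpace ℂ (ιA × ιB)) (δ δ' : ℝ) (j : ℕ) (hj : ∀ i < j, ‖kAct (P i) 1 φ‖ ≤ δ)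
    (hj' : ‖kAct (P j) 1 φ - φ‖ ≤ δ') :
    ‖kAct (P j * seqS P j) 1 φ - φ‖ ≤ j * δ + δ' := by
  have h1 := seq_err (fun k => Matrix.toEuclideanLin ((P k) ⊗ₖ (1 : Matrix ιB ιB ℂ)))
    (fun k => kAct (seqS P k) 1 φ) φ δ (by simp [seqS, kAct_one])
    (fun k => by
      change _ = _ - kAct (P k) 1 _
      rw [← kAct_mul, one_mul, ← kAct_subA, seqS, sub_mul, one_mul])
    (fun k v => by
      change ‖v - kAct (P k) 1 v‖ ≤ _
      have := kAct_projA (1 - P k) (proj_compl (h k) (h' k)).1 (proj_compl (h k) (h' k)).2 v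
      rwa [kAct_subA, kAct_one] at this) j hj
  have e : kAct (P j * seqS P j) 1 φ - φ
      = kAct (P j) 1 (kAct (seqS P j) 1 φ - φ) + (kAct (P j) 1 φ - φ) := by
    rw [kAct_sub, ← kAct_mul, one_mul]; abel
  rw [e]
  exact (norm_add_le _ _).trans
    (add_le_add ((kAct_projA _ (h j) (h' j) _).trans h1) hj')

lemma errB (P : ℕ → Matrix ιB ιB ℂ) (h : ∀ k, (P k).IsHermitian) (h' : ∀ k, P k * P k = P k)
    (φ : EuclideanSpace ℂ (ιA × ιB)) (δ δ' : ℝ) (j : ℕ) (hj : ∀ i < j, ‖kAct 1 (P i) φ‖ ≤ δ)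
    (hj' : ‖kAct 1 (P j) φ - φ‖ ≤ δ') :
    ‖kAct 1 (P j * seqS P j) φ - φ‖ ≤ j * δ + δ' := by
  have h1 := seq_err (fun k => Matrix.toEuclideanLin ((1 : Matrix ιA ιA ℂ) ⊗ₖ (P k)))
    (fun k => kAct 1 (seqS P k) φ) φ δ (by simp [seqS, kAct_one])
    (fun k => by
      change _ = _ - kAct 1 (P k) _
      rw [← kAct_mul, one_mul, ← kAct_subB, seqS, sub_mul, one_mul])
    (fun k v => by
      change ‖v - kAct 1 (P k) v‖ ≤ _
      have := kAct_projB (1 - P k) (proj_compl (h k) (h' k)).1 (proj_compl (h k) (h' k)).2 v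
      rwa [kAct_subB, kAct_one] at this) j hj
  have e : kAct 1 (P j * seqS P j) φ - φ
      = kAct 1 (P j) (kAct 1 (seqS P j) φ - φ) + (kAct 1 (P j) φ - φ) := by
    rw [kAct_sub, ← kAct_mul, one_mul]; abel
  rw [e]
  exact (norm_add_le _ _).trans
    (add_le_add ((kAct_projB _ (h j) (h' j) _).trans h1) hj')

lemma seqS_contrA (P : ℕ → Matrix ιA ιA ℂ) (h : ∀ k, (P k).IsHermitian)
    (h' : ∀ k, P k * P k = P k) (k : ℕ) (v : EuclideanSpace ℂ (ιA × ιB)) :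
    ‖kAct (seqS P k) 1 v‖ ≤ ‖v‖ := by
  induction k with
  | zero => simp [seqS, kAct_one]
  | succ k ih =>
    rw [seqS, ← one_mul (1 : Matrix ιB ιB ℂ), kAct_mul]
    exact (kAct_projA _ (proj_compl (h k) (h' k)).1 (proj_compl (h k) (h' k)).2 _).trans ih

end act

section iso
variable {ι : Type*} [Fintype ι] [DecidableEq ι] {d : ℕ}

/-- The local isometry. -/
noncomputable def PhiM (X : Fin d → Matrix ι ι ℂ) (K : ℕ → Matrix ι ι ℂ) :
    Matrix (Fin (Fintype.card ι) × Fin d) ι ℂ :=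
  fun p x => (X p.2 * K p.2) ((Fintype.equivFin ι).symm p.1) x

/-- Embedding at register value `j`. -/
noncomputable def JM (j : Fin d) : Matrix (Fin (Fintype.card ι) × Fin d) ι ℂ :=
  fun p x => if p.2 = j ∧ (Fintype.equivFin ι).symm p.1 = x then 1 else 0

lemma JM_Phi (X : Fin d → Matrix ι ι ℂ) (K : ℕ → Matrix ι ι ℂ) (j : Fin d) :
    (JM j : Matrix (Fin (Fintype.card ι) × Fin d) ι ℂ)ᴴ * PhiM X K = X j * K j := by
  ext a b
  rw [Matrix.mul_apply (M := (JM j : Matrix (Fin (Fintype.card ι) × Fin d) ι ℂ)ᴴ), Fintype.sum_prod_type, ← (Fintype.equivFin ι).sum_comp]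
  simp [JM, PhiM, ite_and, apply_ite (starRingEnd ℂ)]

lemma JM_iso (j : Fin d) : (JM j : Matrix (Fin (Fintype.card ι) × Fin d) ι ℂ)ᴴ *
    (JM j : Matrix (Fin (Fintype.card ι) × Fin d) ι ℂ) = 1 := by
  ext a b
  rw [Matrix.mul_apply, Fintype.sum_prod_type, ← (Fintype.equivFin ι).sum_comp]
  simp [JM, ite_and, Matrix.one_apply, eq_comm]

lemma Phi_iso (X : Fin d → Matrix ι ι ℂ) (K : ℕ → Matrix ι ι ℂ) (hX : ∀ k, (X k)ᴴ * X k = 1)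
    (hK : ∑ k ∈ Finset.range d, (K k)ᴴ * K k = 1) : (PhiM X K)ᴴ * PhiM X K = 1 := by
  have e : (PhiM X K)ᴴ * PhiM X K = ∑ k : Fin d, (X k * K k)ᴴ * (X k * K k) := by
    ext a b
    rw [Matrix.mul_apply, Fintype.sum_prod_type_right, Matrix.sum_apply]
    refine Finset.sum_congr rfl fun k _ => ?_
    rw [← (Fintype.equivFin ι).sum_comp, Matrix.mul_apply]
    simp [PhiM]
  rw [e, ← hK, ← Fin.sum_univ_eq_sum_range (fun k => (K k)ᴴ * K k)]
  refine Finset.sum_congr rfl fun k _ => ?_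
  rw [Matrix.conjTranspose_mul, Matrix.mul_assoc, ← Matrix.mul_assoc (X k)ᴴ, hX, one_mul]

/-- Completed projections. -/
noncomputable def PC (P : Fin d → Matrix ι ι ℂ) (k : ℕ) : Matrix ι ι ℂ :=
  if h : k + 1 < d then P ⟨k, by omega⟩ else 1

lemma PC_proj (P : Fin d → Matrix ι ι ℂ) (h : ∀ k, (P k).IsHermitian ∧ P k * P k = P k) (k : ℕ) :
    (PC P k).IsHermitian ∧ PC P k * PC P k = PC P k := by
  unfold PC
  split_ifs
  · exact h _
  · exact ⟨Matrix.isHermitian_one, one_mul 1⟩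

lemma PC_sum (P : Fin d → Matrix ι ι ℂ) (h : ∀ k, (P k).IsHermitian ∧ P k * P k = P k)
    (hd : 0 < d) :
    ∑ k ∈ Finset.range d, (PC P k * seqS (PC P) k)ᴴ * (PC P k * seqS (PC P) k) = 1 := by
  rw [seqS_sum _ (fun k => (PC_proj P h k).1) (fun k => (PC_proj P h k).2)]
  obtain ⟨e, rfl⟩ : ∃ e, d = e + 1 := ⟨d - 1, by omega⟩
  have : PC P e = 1 := by simp [PC]
  simp [seqS, this]

end iso

lemma targetVec_sub {nA nB d : ℕ} (x y : EuclideanSpace ℂ (Fin nA × Fin nB)) (c : Fin d → ℝ) :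
    targetVec (x - y) c = targetVec x c - targetVec y c := by
  ext p
  by_cases h : p.1.2 = p.2.2 <;> simp [targetVec, sub_mul, h]

lemma targetVec_norm {nA nB d : ℕ} (x : EuclideanSpace ℂ (Fin nA × Fin nB)) (c : Fin d → ℝ)
    (hc : ∑ i, c i ^ 2 = 1) : ‖targetVec x c‖ = ‖x‖ := by
  rw [EuclideanSpace.norm_eq, EuclideanSpace.norm_eq]
  congr 1
  rw [Fintype.sum_prod_type, Fintype.sum_prod_type, Fintype.sum_prod_type]
  refine Finset.sum_congr rfl fun a _ => ?_
  simp_rw [Fintype.sum_prod_type]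
  rw [Finset.sum_comm]
  refine Finset.sum_congr rfl fun b _ => ?_
  rw [← mul_one (‖x (a, b)‖ ^ 2), ← hc, Finset.mul_sum]
  refine Finset.sum_congr rfl fun k _ => ?_
  rw [Finset.sum_eq_single k]
  · simp [targetVec, mul_pow]
  · intro l _ hl
    simp [targetVec, Ne.symm hl]
  · simp

/-- reindexed vector -/
noncomputable def reVec {ιA ιB : Type*} [Fintype ιA] [Fintype ιB] (x : EuclideanSpace ℂ (ιA × ιB)) :
    EuclideanSpace ℂ (Fin (Fintype.card ιA) × Fin (Fintype.card ιB)) :=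
  WithLp.toLp 2 fun q => x ((Fintype.equivFin ιA).symm q.1, (Fintype.equivFin ιB).symm q.2)

lemma target_eq {ιA ιB : Type*} [Fintype ιA] [Fintype ιB] [DecidableEq ιA] [DecidableEq ιB] {d : ℕ}
    (x : EuclideanSpace ℂ (ιA × ιB)) (c : Fin d → ℝ) :
    ∑ j, ((c j : ℝ) : ℂ) • kActRect (JM j) (JM j) x = targetVec (reVec x) c := by
  have key : ∀ (j : Fin d) (q : (Fin (Fintype.card ιA) × Fin d) × (Fin (Fintype.card ιB) × Fin d)),
      kActRect (JM j) (JM j) x q = if q.1.2 = j ∧ q.2.2 = j then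
        x ((Fintype.equivFin ιA).symm q.1.1, (Fintype.equivFin ιB).symm q.2.1) else 0 := by
    intro j q
    simp only [kActRect, Matrix.toEuclideanLin, Matrix.toLpLin_apply, Matrix.mulVec, dotProduct,
      Fintype.sum_prod_type, Matrix.kroneckerMap_apply, JM]
    by_cases h1 : q.1.2 = j <;> by_cases h2 : q.2.2 = j <;> simp [h1, h2]
  ext q
  simp only [WithLp.ofLp_sum, Finset.sum_apply, PiLp.smul_apply, key, smul_eq_mul, targetVec, reVec]
  rw [Finset.sum_eq_single q.1.2]
  · by_cases h : q.1.2 = q.2.2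
    · simp [h, mul_comm]
    · simp [h, Ne.symm h]
  · intro j _ hj
    simp [Ne.symm hj]
  · simp

lemma main_bound {ιA ιB : Type} [Fintype ιA] [Fintype ιB] [DecidableEq ιA] [DecidableEq ιB]
    (d : ℕ) (hd : 0 < d) (c : Fin d → ℝ) (hc : ∀ i, 0 < c i)
    (ψ : EuclideanSpace ℂ (ιA × ιB)) (hψ : ‖ψ‖ = 1)
    (PA : Fin d → Matrix ιA ιA ℂ) (PB : Fin d → Matrix ιB ιB ℂ)
    (XA : Fin d → Matrix ιA ιA ℂ) (XB : Fin d → Matrix ιB ιB ℂ)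
    (hPA : ∀ k, (PA k).IsHermitian ∧ PA k * PA k = PA k)
    (hPB : ∀ k, (PB k).IsHermitian ∧ PB k * PB k = PB k)
    (hXA : ∀ k, (XA k)ᴴ * XA k = 1) (hXB : ∀ k, (XB k)ᴴ * XB k = 1)
    (ε : ℝ) (hε : 0 ≤ ε)
    (h1 : ∀ i j, i ≠ j → ‖kAct (PA i * PA j) 1 ψ‖ ≤ ε)
    (h2 : ‖kAct (∑ k, PA k) 1 ψ - ψ‖ ≤ ε)
    (h3 : ∀ k, ‖kAct (PA k) 1 ψ - kAct 1 (PB k) ψ‖ ≤ ε)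
    (h4 : ∀ k, ‖kAct (XA k) (XB k) (kAct (PA k) 1 ψ)
              - ((c k / c ⟨0, hd⟩ : ℝ) : ℂ) • kAct (PA ⟨0, hd⟩) 1 ψ‖ ≤ ε) :
    ∃ (ΦA : Matrix (Fin (Fintype.card ιA) × Fin d) ιA ℂ)
      (ΦB : Matrix (Fin (Fintype.card ιB) × Fin d) ιB ℂ)
      (y : EuclideanSpace ℂ (Fin (Fintype.card ιA) × Fin (Fintype.card ιB))),
      ΦAᴴ * ΦA = 1 ∧ ΦBᴴ * ΦB = 1 ∧
      ‖kActRect ΦA ΦB ψ - targetVec y c‖ ≤ ε + d * (3 * Real.sqrt d * Real.sqrt ε + ε) := by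
  set KA : ℕ → Matrix ιA ιA ℂ := fun k => PC PA k * seqS (PC PA) k with hKA
  set KB : ℕ → Matrix ιB ιB ℂ := fun k => PC PB k * seqS (PC PB) k with hKB
  have isoA : (PhiM XA KA)ᴴ * PhiM XA KA = 1 := Phi_iso XA KA hXA (PC_sum PA hPA hd)
  have isoB : (PhiM XB KB)ᴴ * PhiM XB KB = 1 := Phi_iso XB KB hXB (PC_sum PB hPB hd)
  set φ : Fin d → EuclideanSpace ℂ (ιA × ιB) := fun j => kAct (PA j) 1 ψ with hφ
  have hφn : ∀ j, ‖φ j‖ ≤ 1 := fun j => by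
    rw [← hψ]; exact kAct_projA _ (hPA j).1 (hPA j).2 ψ
  -- errors
  have eA : ∀ j : Fin d, ‖kAct (KA j) 1 (φ j) - φ j‖ ≤ j * ε + 0 := by
    intro j
    apply errA (PC PA) (fun k => (PC_proj PA hPA k).1) (fun k => (PC_proj PA hPA k).2)
    · intro i hi
      have hj := j.2
      have : PC PA i = PA ⟨i, by omega⟩ := by
        unfold PC; rw [dif_pos (by omega)]
      rw [this, hφ]
      change ‖kAct _ 1 (kAct _ 1 ψ)‖ ≤ ε
      rw [← kAct_mul, one_mul]
      exact h1 _ _ (fun h => by have := congrArg Fin.val h; simp at this; omega)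
    · by_cases hj : (j : ℕ) + 1 < d
      · have : PC PA j = PA j := by unfold PC; rw [dif_pos hj]
        rw [this, hφ]
        change ‖kAct _ 1 (kAct _ 1 ψ) - kAct _ 1 ψ‖ ≤ 0
        rw [← kAct_mul, one_mul, (hPA j).2]
        simp
      · have : PC PA j = 1 := by unfold PC; rw [dif_neg hj]
        rw [this, kAct_one]
        simp
  have comm : ∀ i j, kAct 1 (PB i) (φ j) = kAct (PA j) 1 (kAct 1 (PB i) ψ) := by
    intro i j
    change kAct 1 (PB i) (kAct (PA j) 1 ψ) = _
    rw [← kAct_mul, ← kAct_mul, one_mul, mul_one, one_mul, mul_one]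
  have swap : ∀ i j, ‖kAct 1 (PB i) (φ j) - kAct (PA j * PA i) 1 ψ‖ ≤ ε := by
    intro i j
    have e : kAct (PA j * PA i) 1 ψ = kAct (PA j) 1 (kAct (PA i) 1 ψ) := by
      rw [← kAct_mul, one_mul]
    rw [comm, e, ← kAct_sub]
    refine (kAct_projA _ (hPA j).1 (hPA j).2 _).trans ?_
    rw [norm_sub_rev]
    exact h3 i
  have eB : ∀ j : Fin d, ‖kAct 1 (KB j) (φ j) - φ j‖ ≤ j * (2 * ε) + ε := by
    intro j
    apply errB (PC PB) (fun k => (PC_proj PB hPB k).1) (fun k => (PC_proj PB hPB k).2)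
    · intro i hi
      have hj := j.2
      have : PC PB i = PB ⟨i, by omega⟩ := by
        unfold PC; rw [dif_pos (by omega)]
      rw [this]
      have a1 := swap ⟨i, by omega⟩ j
      have a2 := h1 j ⟨i, by omega⟩ (fun h => by have := congrArg Fin.val h; simp at this; omega)
      have a3 := norm_le_norm_sub_add (kAct 1 (PB ⟨i, by omega⟩) (φ j))
        (kAct (PA j * PA ⟨i, by omega⟩) 1 ψ)
      linarith
    · by_cases hj : (j : ℕ) + 1 < d
      · have : PC PB j = PB j := by unfold PC; rw [dif_pos hj]
        rw [this]
        have a1 := swap j j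
        rwa [(hPA j).2] at a1
      · have : PC PB j = 1 := by unfold PC; rw [dif_neg hj]
        rw [this, kAct_one]
        simpa using hε
  have eAB : ∀ j : Fin d, ‖φ j - kAct (KA j) (KB j) (φ j)‖ ≤ 3 * d * ε := by
    intro j
    have e : φ j - kAct (KA j) (KB j) (φ j)
        = -(kAct (KA j) 1 (φ j) - φ j) - kAct (KA j) 1 (kAct 1 (KB j) (φ j) - φ j) := by
      rw [kAct_sub, ← kAct_mul (KA j) 1 1 (KB j) (φ j), one_mul, mul_one]; abel
    have hcon : ‖kAct (KA j) 1 (kAct 1 (KB j) (φ j) - φ j)‖ ≤ ‖kAct 1 (KB j) (φ j) - φ j‖ := by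
      have e2 : ∀ v : EuclideanSpace ℂ (ιA × ιB), kAct (KA j) 1 v
          = kAct (PC PA j) 1 (kAct (seqS (PC PA) j) 1 v) := by
        intro v; rw [← kAct_mul, one_mul]
      rw [e2]
      exact (kAct_projA _ (PC_proj PA hPA j).1 (PC_proj PA hPA j).2 _).trans
        (seqS_contrA _ (fun k => (PC_proj PA hPA k).1) (fun k => (PC_proj PA hPA k).2) _ _)
    rw [e]
    refine (norm_sub_le _ _).trans ?_
    rw [norm_neg]
    have hj : ((j : ℕ) : ℝ) + 1 ≤ d := by exact_mod_cast j.2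
    have b1 := eA j
    have b2 := eB j
    nlinarith
  have hone : ∀ j : Fin d, ‖kActRect (PhiM XA KA) (PhiM XB KB) (φ j)
      - kActRect (JM j) (JM j) (kAct (XA j) (XB j) (φ j))‖ ≤ 3 * Real.sqrt d * Real.sqrt ε := by
    intro j
    rw [← kActRect_mul (JM j) (XA j) (JM j) (XB j) (φ j)]
    have isoG : ∀ {ι : Type} [Fintype ι] [DecidableEq ι] (X : Matrix ι ι ℂ), Xᴴ * X = 1 →
        ((JM j : Matrix (Fin (Fintype.card ι) × Fin d) ι ℂ) * X)ᴴ *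
          ((JM j : Matrix (Fin (Fintype.card ι) × Fin d) ι ℂ) * X) = 1 := by
      intro ι _ _ X hX
      rw [Matrix.conjTranspose_mul, Matrix.mul_assoc, ← Matrix.mul_assoc _ _ X, JM_iso, one_mul, hX]
    have GW : ∀ {ι : Type} [Fintype ι] [DecidableEq ι] (X : Fin d → Matrix ι ι ℂ)
        (K : ℕ → Matrix ι ι ℂ), (X j)ᴴ * X j = 1 →
        ((JM j : Matrix (Fin (Fintype.card ι) × Fin d) ι ℂ) * X j)ᴴ * PhiM X K = K j := by
      intro ι _ _ X K hX
      rw [Matrix.conjTranspose_mul, Matrix.mul_assoc, JM_Phi, ← Matrix.mul_assoc, hX, one_mul]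
    have key := L_cmp (PhiM XA KA ⊗ₖ PhiM XB KB)
      (((JM j : Matrix (Fin (Fintype.card ιA) × Fin d) ιA ℂ) * XA j) ⊗ₖ
        ((JM j : Matrix (Fin (Fintype.card ιB) × Fin d) ιB ℂ) * XB j))
      (kron_iso isoA isoB) (kron_iso (isoG _ (hXA j)) (isoG _ (hXB j))) (φ j) (3 * d * ε)
      (by
        rw [Matrix.conjTranspose_kronecker, ← Matrix.mul_kronecker_mul, GW XA KA (hXA j),
          GW XB KB (hXB j)]
        exact eAB j) (hφn j)
    refine abs_le_of_sq_le_sq' ?_ (by positivity) |>.2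
    refine key.trans ?_
    rw [mul_pow, mul_pow, Real.sq_sqrt (by positivity), Real.sq_sqrt hε]
    have : 0 ≤ (d : ℝ) * ε := by positivity
    nlinarith
  set c0 := c ⟨0, hd⟩ with hc0
  set x : EuclideanSpace ℂ (ιA × ιB) := ((c0⁻¹ : ℝ) : ℂ) • φ ⟨0, hd⟩ with hx
  refine ⟨PhiM XA KA, PhiM XB KB, reVec x, isoA, isoB, ?_⟩
  rw [← target_eq]
  have htwo : ∀ j : Fin d, ‖kActRect (PhiM XA KA) (PhiM XB KB) (φ j)
      - ((c j : ℝ) : ℂ) • kActRect (JM j) (JM j) x‖ ≤ 3 * Real.sqrt d * Real.sqrt ε + ε := by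
    intro j
    have e : ((c j : ℝ) : ℂ) • kActRect (JM j : Matrix (Fin (Fintype.card ιA) × Fin d) ιA ℂ)
        (JM j : Matrix (Fin (Fintype.card ιB) × Fin d) ιB ℂ) x
        = kActRect (JM j) (JM j) (((c j / c0 : ℝ) : ℂ) • φ ⟨0, hd⟩) := by
      simp only [kActRect, hx, map_smul, smul_smul]
      congr 1
      push_cast
      rw [div_eq_mul_inv]
    have h5 : ‖kActRect (JM j : Matrix (Fin (Fintype.card ιA) × Fin d) ιA ℂ)
        (JM j : Matrix (Fin (Fintype.card ιB) × Fin d) ιB ℂ) (kAct (XA j) (XB j) (φ j))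
        - ((c j : ℝ) : ℂ) • kActRect (JM j) (JM j) x‖ ≤ ε := by
      rw [e]
      simp only [kActRect]
      rw [← map_sub, L_iso _ (kron_iso (JM_iso j) (JM_iso j))]
      exact h4 j
    exact (norm_sub_le_norm_sub_add_norm_sub _ _ _).trans (add_le_add (hone j) h5)
  have hsum : kAct (∑ k, PA k) 1 ψ = ∑ k, φ k := by
    have : (∑ k, PA k) ⊗ₖ (1 : Matrix ιB ιB ℂ) = ∑ k, (PA k ⊗ₖ (1 : Matrix ιB ιB ℂ)) := by
      ext a b
      simp [Matrix.sum_apply, Finset.sum_mul]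
    simp [kAct, hφ, this]
  have hfin : kActRect (PhiM XA KA) (PhiM XB KB) ψ
      - ∑ j, ((c j : ℝ) : ℂ) • kActRect (JM j) (JM j) x
      = -kActRect (PhiM XA KA) (PhiM XB KB) (kAct (∑ k, PA k) 1 ψ - ψ)
        + ∑ j, (kActRect (PhiM XA KA) (PhiM XB KB) (φ j)
          - ((c j : ℝ) : ℂ) • kActRect (JM j) (JM j) x) := by
    rw [hsum, Finset.sum_sub_distrib]
    simp only [kActRect, map_sub, map_sum]
    abel
  rw [hfin]
  refine (norm_add_le _ _).trans (add_le_add ?_ ?_)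
  · rw [norm_neg]
    simp only [kActRect]
    rw [L_iso _ (kron_iso isoA isoB)]
    exact h2
  · refine (norm_sum_le _ _).trans ((Finset.sum_le_sum fun j _ => htwo j).trans ?_)
    simp [mul_add]

/-- The robust Yang–Navascués self-testing criterion: if the four conditions hold up to `ε`
in norm on a unit state `ψ`, then there is a local isometry `Φ_A ⊗ Φ_B` and a state `|extra⟩`
with `‖Φ(ψ) − |extra⟩ ⊗ ∑_i c_i |ii⟩‖ = O(d^{5/2} ε^{1/2})`. -/
theorem stmt12 : ∃ C : ℝ, 0 < C ∧
    ∀ (ιA ιB : Type) [Fintype ιA] [Fintype ιB] [DecidableEq ιA] [DecidableEq ιB]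
      (d : ℕ) (hd : 0 < d) (c : Fin d → ℝ),
      (∀ i, 0 < c i ∧ c i < 1) → (∑ i, c i ^ 2 = 1) →
    ∀ (ψ : EuclideanSpace ℂ (ιA × ιB)), ‖ψ‖ = 1 →
    ∀ (PA : Fin d → Matrix ιA ιA ℂ) (PB : Fin d → Matrix ιB ιB ℂ)
      (XA : Fin d → Matrix ιA ιA ℂ) (XB : Fin d → Matrix ιB ιB ℂ),
      (∀ k, (PA k).IsHermitian ∧ PA k * PA k = PA k) →
      (∀ k, (PB k).IsHermitian ∧ PB k * PB k = PB k) →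
      (∀ k, XA k * (XA k)ᴴ = 1 ∧ (XA k)ᴴ * XA k = 1) →
      (∀ k, XB k * (XB k)ᴴ = 1 ∧ (XB k)ᴴ * XB k = 1) →
    ∀ ε : ℝ, 0 ≤ ε →
      (∀ i j, i ≠ j → ‖kAct (PA i * PA j) 1 ψ‖ ≤ ε) →
      (‖kAct (∑ k, PA k) 1 ψ - ψ‖ ≤ ε) →
      (∀ k, ‖kAct (PA k) 1 ψ - kAct 1 (PB k) ψ‖ ≤ ε) →
      (∀ k, ‖kAct (XA k) (XB k) (kAct (PA k) 1 ψ)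
              - ((c k / c ⟨0, hd⟩ : ℝ) : ℂ) • kAct (PA ⟨0, hd⟩) 1 ψ‖ ≤ ε) →
      ∃ (nA nB : ℕ)
        (ΦA : Matrix (Fin nA × Fin d) ιA ℂ) (ΦB : Matrix (Fin nB × Fin d) ιB ℂ)
        (extra : EuclideanSpace ℂ (Fin nA × Fin nB)),
        ΦAᴴ * ΦA = 1 ∧ ΦBᴴ * ΦB = 1 ∧ ‖extra‖ = 1 ∧
        ‖kActRect ΦA ΦB ψ - targetVec extra c‖
          ≤ C * ((d : ℝ) ^ ((5 : ℝ) / 2)) * Real.sqrt ε := by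
  refine ⟨10, by norm_num, ?_⟩
  intro ιA ιB _ _ _ _ d hd c hc hcs ψ hψ PA PB XA XB hPA hPB hXA hXB ε hε h1 h2 h3 h4
  obtain ⟨ΦA, ΦB, y, hA, hB, hy⟩ := main_bound d hd c (fun i => (hc i).1) ψ hψ PA PB XA XB hPA hPB
    (fun k => (hXA k).2) (fun k => (hXB k).2) ε hε h1 h2 h3 h4
  have hne : Nonempty (ιA × ιB) := by
    by_contra hcon
    rw [not_nonempty_iff] at hcon
    have : ψ = 0 := by ext i; exact hcon.elim i
    rw [this, norm_zero] at hψ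
    exact zero_ne_one hψ
  obtain ⟨⟨a0, b0⟩⟩ := hne
  have hW : ‖kActRect ΦA ΦB ψ‖ = 1 := by
    rw [← hψ]; exact L_iso _ (kron_iso hA hB) ψ
  have hd1 : (1 : ℝ) ≤ d := by exact_mod_cast hd
  have hs1 : 1 ≤ Real.sqrt d := Real.one_le_sqrt.2 hd1
  have hsd : Real.sqrt d ^ 2 = d := Real.sq_sqrt (by linarith)
  have hpow : (d : ℝ) ^ ((5 : ℝ) / 2) = (d : ℝ) ^ 2 * Real.sqrt d := by
    rw [show ((5 : ℝ) / 2) = 2 + 1 / 2 by norm_num, Real.rpow_add (by linarith),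
      Real.sqrt_eq_rpow]
    norm_num
  have hD1 : (1 : ℝ) ≤ (d : ℝ) ^ ((5 : ℝ) / 2) := Real.one_le_rpow hd1 (by norm_num)
  refine ⟨_, _, ΦA, ΦB, ?_⟩
  have unit_case : 2 ≤ 10 * ((d : ℝ) ^ ((5 : ℝ) / 2)) * Real.sqrt ε →
      ∃ extra : EuclideanSpace ℂ (Fin (Fintype.card ιA) × Fin (Fintype.card ιB)),
        ΦAᴴ * ΦA = 1 ∧ ΦBᴴ * ΦB = 1 ∧ ‖extra‖ = 1 ∧
        ‖kActRect ΦA ΦB ψ - targetVec extra c‖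
          ≤ 10 * ((d : ℝ) ^ ((5 : ℝ) / 2)) * Real.sqrt ε := by
    intro h
    have he : ‖(EuclideanSpace.single (Fintype.equivFin ιA a0, Fintype.equivFin ιB b0) 1 :
      EuclideanSpace ℂ (Fin (Fintype.card ιA) × Fin (Fintype.card ιB)))‖ = 1 := by simp
    refine ⟨_, hA, hB, he, ?_⟩
    refine (norm_sub_le _ _).trans ?_
    rw [hW, targetVec_norm _ _ hcs, he]
    linarith
  rcases le_or_gt ε 1 with hε1 | hε1
  · have hse : Real.sqrt ε ^ 2 = ε := Real.sq_sqrt hε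
    have hse0 := Real.sqrt_nonneg ε
    have hse1 : Real.sqrt ε ≤ 1 := Real.sqrt_le_one.2 hε1
    have hεs : ε ≤ Real.sqrt ε := by nlinarith
    have hδ : ‖kActRect ΦA ΦB ψ - targetVec y c‖
        ≤ 5 * ((d : ℝ) ^ ((5 : ℝ) / 2)) * Real.sqrt ε := by
      refine hy.trans ?_
      rw [hpow]
      have q1 : (d : ℝ) ≤ (d : ℝ) ^ 2 := by nlinarith
      have q2 : (d : ℝ) ^ 2 ≤ (d : ℝ) ^ 2 * Real.sqrt d := by nlinarith
      have q3 : (d : ℝ) * Real.sqrt d ≤ (d : ℝ) ^ 2 * Real.sqrt d := by nlinarith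
      have q4 : ε + d * (3 * Real.sqrt d * Real.sqrt ε + ε)
          ≤ Real.sqrt ε + d * (3 * Real.sqrt d * Real.sqrt ε + Real.sqrt ε) := by gcongr
      refine q4.trans ?_
      have q5 : 1 + 3 * (d * Real.sqrt d) + d ≤ 5 * ((d : ℝ) ^ 2 * Real.sqrt d) := by linarith
      have := mul_le_mul_of_nonneg_right q5 hse0
      linarith
    have hyn : |1 - ‖y‖| ≤ 5 * ((d : ℝ) ^ ((5 : ℝ) / 2)) * Real.sqrt ε := by
      have := abs_norm_sub_norm_le (kActRect ΦA ΦB ψ) (targetVec y c)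
      rw [hW, targetVec_norm _ _ hcs] at this
      exact this.trans hδ
    by_cases hy0 : y = 0
    · apply unit_case
      rw [hy0, norm_zero, sub_zero, abs_one] at hyn
      linarith
    · have hyp : 0 < ‖y‖ := norm_pos_iff.2 hy0
      refine ⟨((‖y‖⁻¹ : ℝ) : ℂ) • y, hA, hB, ?_, ?_⟩
      · rw [norm_smul]
        simp [hyp.ne']
      · have e : y - ((‖y‖⁻¹ : ℝ) : ℂ) • y = ((1 - ‖y‖⁻¹ : ℝ) : ℂ) • y := by
          push_cast
          rw [sub_smul, one_smul]
        have hn : ‖targetVec y c - targetVec (((‖y‖⁻¹ : ℝ) : ℂ) • y) c‖ = |1 - ‖y‖| := by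
          rw [← targetVec_sub, targetVec_norm _ _ hcs, e, norm_smul, Complex.norm_real,
            Real.norm_eq_abs, ← abs_of_pos hyp, ← abs_mul, abs_of_pos hyp, abs_sub_comm 1]
          congr 1
          field_simp
        have := norm_sub_le_norm_sub_add_norm_sub (kActRect ΦA ΦB ψ) (targetVec y c)
          (targetVec (((‖y‖⁻¹ : ℝ) : ℂ) • y) c)
        rw [hn] at this
        linarith
  · apply unit_case
    have : 1 ≤ Real.sqrt ε := Real.one_le_sqrt.2 hε1.le
    nlinarith
end
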